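/- arXiv:2410.10990 — 2 statements merged into one kernel-verified Lean document; each statement's English description precedes it below -/
import Mathlib

section
/- Let R be a commutative Noetherian ring of prime characteristic p > 0, let I, 𝔞 ⊆ R be ideals with I ∩ R° ≠ ∅ and 𝔞 ∩ R° ≠ ∅, and let t > 0 be a real number. Then the adjusted closures are insensitive to first taking the corresponding unadjusted closure: (a) (I^F)^{F𝔞ᵗ} = I^{F𝔞ᵗ} and ^{𝔞ᵗ}(I^F)^F = ^{𝔞ᵗ}I^F; (b) (I*)^{*𝔞ᵗ} = I^{*𝔞ᵗ} and ^{𝔞ᵗ}(I*)* = ^{𝔞ᵗ}I*; (c) J̄^{𝔞ᵗ} = Ī^{𝔞ᵗ} where J = Ī is the integral closure of I. -/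
open Ideal Filter
open scoped Pointwise

/-- `R°`: the set of elements of `R` not contained in any minimal prime of `R`. -/
def Rcirc (R : Type*) [CommRing R] : Set R :=
  {c | ∀ P ∈ minimalPrimes R, c ∉ P}

/-- The integral closure of an ideal `I`: elements satisfying an equation
`x^n + r₁ x^{n-1} + ⋯ + rₙ = 0` with `rᵢ ∈ Iⁱ`. -/
def intCl {R : Type*} [CommRing R] (I : Ideal R) : Set R :=
  {x | ∃ n : ℕ, 0 < n ∧ ∃ r : ℕ → R,
    (∀ i, 1 ≤ i → i ≤ n → r i ∈ I ^ i) ∧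
    x ^ n + ∑ i ∈ Finset.range n, r (i + 1) * x ^ (n - (i + 1)) = 0}

/-- The Hara–Yoshida `𝔞^t`-integral closure of `I`. -/
def HYIntCl {R : Type*} [CommRing R] (I a : Ideal R) (t : ℝ) : Set R :=
  {x | ∃ c ∈ Rcirc R, ∃ N : ℕ, ∀ n : ℕ, N ≤ n →
    ∀ y ∈ a ^ ⌈t * (n : ℝ)⌉₊, c * x ^ n * y ∈ I ^ n}

/-- The Vraciu `𝔞^t`-integral closure of `I`. -/
def VIntCl {R : Type*} [CommRing R] (I a : Ideal R) (t : ℝ) : Set R :=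
  {x | ∃ c ∈ Rcirc R, ∃ N : ℕ, ∀ n : ℕ, N ≤ n →
    ∀ y ∈ a ^ ⌈t * (n : ℝ)⌉₊, c * x ^ n * y ∈ a ^ ⌈t * (n : ℝ)⌉₊ * I ^ n}

/-- The `q`-th Frobenius bracket power `I^{[q]}`: the ideal generated by `q`-th powers
of elements of `I`. -/
def fbp {R : Type*} [CommRing R] (I : Ideal R) (q : ℕ) : Ideal R :=
  Ideal.span ((fun x => x ^ q) '' (I : Set R))

/-- The Frobenius closure `I^F` (in characteristic `p`). -/
def frobCl {R : Type*} [CommRing R] (p : ℕ) (I : Ideal R) : Set R :=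
  {x | ∃ e : ℕ, x ^ p ^ e ∈ fbp I (p ^ e)}

/-- The tight closure `I^*` (in characteristic `p`). -/
def tightCl {R : Type*} [CommRing R] (p : ℕ) (I : Ideal R) : Set R :=
  {x | ∃ c ∈ Rcirc R, ∃ E : ℕ, ∀ e : ℕ, E ≤ e → c * x ^ p ^ e ∈ fbp I (p ^ e)}

/-- The Hara–Yoshida `𝔞^t`-Frobenius closure of `I`. -/
def HYFrobCl {R : Type*} [CommRing R] (p : ℕ) (I a : Ideal R) (t : ℝ) : Set R :=
  {x | ∃ E : ℕ, ∀ e : ℕ, E ≤ e →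
    ∀ y ∈ a ^ ⌈t * (p : ℝ) ^ e⌉₊, x ^ p ^ e * y ∈ fbp I (p ^ e)}

/-- The Vraciu `𝔞^t`-Frobenius closure of `I`. -/
def VFrobCl {R : Type*} [CommRing R] (p : ℕ) (I a : Ideal R) (t : ℝ) : Set R :=
  {x | ∃ E : ℕ, ∀ e : ℕ, E ≤ e →
    ∀ y ∈ a ^ ⌈t * (p : ℝ) ^ e⌉₊, x ^ p ^ e * y ∈ a ^ ⌈t * (p : ℝ) ^ e⌉₊ * fbp I (p ^ e)}

/-- The Hara–Yoshida `𝔞^t`-tight closure of `I`. -/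
def HYTightCl {R : Type*} [CommRing R] (p : ℕ) (I a : Ideal R) (t : ℝ) : Set R :=
  {x | ∃ c ∈ Rcirc R, ∃ E : ℕ, ∀ e : ℕ, E ≤ e →
    ∀ y ∈ a ^ ⌈t * (p : ℝ) ^ e⌉₊, c * x ^ p ^ e * y ∈ fbp I (p ^ e)}

/-- The Vraciu `𝔞^t`-tight closure of `I`. -/
def VTightCl {R : Type*} [CommRing R] (p : ℕ) (I a : Ideal R) (t : ℝ) : Set R :=
  {x | ∃ c ∈ Rcirc R, ∃ E : ℕ, ∀ e : ℕ, E ≤ e →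
    ∀ y ∈ a ^ ⌈t * (p : ℝ) ^ e⌉₊, c * x ^ p ^ e * y ∈ a ^ ⌈t * (p : ℝ) ^ e⌉₊ * fbp I (p ^ e)}

/-- The `t`-th rational power of an ideal `𝔞`, for `t = num/den ∈ ℚ`. -/
def ratPow {R : Type*} [CommRing R] (a : Ideal R) (t : ℚ) : Set R :=
  {x | x ^ t.den ∈ intCl (a ^ t.num.toNat)}

/-- `μ(𝔞)`: the minimal number of generators of the ideal `𝔞`. -/
noncomputable def mu {R : Type*} [CommRing R] (a : Ideal R) : ℕ :=
  sInf {m | ∃ s : Finset R, s.card = m ∧ Ideal.span (s : Set R) = a}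

section AdjustedClosures

variable {R : Type*} [CommRing R]

lemma one_mem_Rcirc : (1 : R) ∈ Rcirc R := fun _ hP h ↦
  hP.1.1.ne_top ((Ideal.eq_top_iff_one _).2 h)

lemma mul_mem_Rcirc {c d : R} (hc : c ∈ Rcirc R) (hd : d ∈ Rcirc R) : c * d ∈ Rcirc R :=
  fun P hP h ↦ (hP.1.1.mem_or_mem h).elim (hc P hP) (hd P hP)

lemma pow_mem_Rcirc {c : R} (hc : c ∈ Rcirc R) (n : ℕ) : c ^ n ∈ Rcirc R := by
  induction n with
  | zero => simpa using one_mem_Rcirc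
  | succ n ih => exact pow_succ c n ▸ mul_mem_Rcirc ih hc

lemma fbp_mono {I J : Ideal R} (h : I ≤ J) (q : ℕ) : fbp I q ≤ fbp J q :=
  Ideal.span_mono (Set.image_mono h)

lemma fbp_eq_map (p : ℕ) [ExpChar R p] (I : Ideal R) (e : ℕ) :
    fbp I (p ^ e) = I.map (iterateFrobenius R p e) := rfl

lemma fbp_sup (p : ℕ) [ExpChar R p] (I J : Ideal R) (e : ℕ) :
    fbp (I ⊔ J) (p ^ e) = fbp I (p ^ e) ⊔ fbp J (p ^ e) := by
  simp only [fbp_eq_map, Ideal.map_sup]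

lemma fbp_span_singleton (p : ℕ) [ExpChar R p] (x : R) (e : ℕ) :
    fbp (span {x}) (p ^ e) = span {x ^ p ^ e} := by
  rw [fbp_eq_map, Ideal.map_span, Set.image_singleton, iterateFrobenius_def]

lemma fbp_fbp (p : ℕ) [ExpChar R p] (I : Ideal R) (e f : ℕ) :
    fbp (fbp I (p ^ e)) (p ^ f) = fbp I (p ^ (e + f)) := by
  rw [fbp_eq_map, fbp_eq_map, fbp_eq_map, Ideal.map_map]
  congr 1
  ext x
  simp [iterateFrobenius_def, pow_add, pow_mul]

lemma subset_frobCl (p : ℕ) (I : Ideal R) : (I : Set R) ⊆ frobCl p I :=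
  fun x hx ↦ ⟨0, Ideal.subset_span ⟨x, hx, rfl⟩⟩

lemma subset_tightCl (p : ℕ) (I : Ideal R) : (I : Set R) ⊆ tightCl p I :=
  fun x hx ↦ ⟨1, one_mem_Rcirc, 0, fun e _ ↦ by
    rw [one_mul]; exact Ideal.subset_span ⟨x, hx, rfl⟩⟩

lemma subset_intCl (I : Ideal R) : (I : Set R) ⊆ intCl I := fun x hx ↦
  ⟨1, one_pos, fun _ ↦ -x, fun i h1 h2 ↦ by
    obtain rfl : i = 1 := le_antisymm h2 h1
    simpa using hx, by simp⟩

/-- An ideal generated by elements of `I^F` satisfies `K^{[q]} ⊆ I^{[q]}` for all large `q`. -/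
lemma exists_fbp_le_of_subset_frobCl (p : ℕ) [ExpChar R p] {I K : Ideal R} (hK : K.FG)
    (h : (K : Set R) ⊆ frobCl p I) :
    ∃ E : ℕ, ∀ e, E ≤ e → fbp K (p ^ e) ≤ fbp I (p ^ e) := by
  induction K, hK using Submodule.fg_induction with
  | singleton x =>
    obtain ⟨E, hE⟩ := h (Ideal.mem_span_singleton_self x)
    refine ⟨E, fun e he ↦ ?_⟩
    obtain ⟨f, rfl⟩ := Nat.exists_eq_add_of_le he
    rw [← fbp_fbp, ← fbp_fbp p I]
    refine fbp_mono ?_ _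
    rw [Ideal.submodule_span_eq, fbp_span_singleton]
    exact (Ideal.span_singleton_le_iff_mem _).2 hE
  | sup K₁ K₂ _ _ ih₁ ih₂ =>
    obtain ⟨E₁, h₁⟩ := ih₁ (fun x hx ↦ h (Ideal.mem_sup_left hx))
    obtain ⟨E₂, h₂⟩ := ih₂ (fun x hx ↦ h (Ideal.mem_sup_right hx))
    refine ⟨max E₁ E₂, fun e he ↦ ?_⟩
    rw [fbp_sup]
    exact sup_le (h₁ e (le_of_max_le_left he)) (h₂ e (le_of_max_le_right he))

/-- An ideal generated by elements of `I^*` has a uniform multiplier `c ∈ R°`. -/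
lemma exists_mul_fbp_le_of_subset_tightCl (p : ℕ) [ExpChar R p] {I K : Ideal R} (hK : K.FG)
    (h : (K : Set R) ⊆ tightCl p I) :
    ∃ c ∈ Rcirc R, ∃ E : ℕ, ∀ e, E ≤ e → span {c} * fbp K (p ^ e) ≤ fbp I (p ^ e) := by
  induction K, hK using Submodule.fg_induction with
  | singleton x =>
    obtain ⟨c, hc, E, hE⟩ := h (Ideal.mem_span_singleton_self x)
    refine ⟨c, hc, E, fun e he ↦ ?_⟩
    rw [Ideal.submodule_span_eq, fbp_span_singleton, Ideal.span_singleton_mul_span_singleton]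
    exact (Ideal.span_singleton_le_iff_mem _).2 (hE e he)
  | sup K₁ K₂ _ _ ih₁ ih₂ =>
    obtain ⟨c₁, hc₁, E₁, h₁⟩ := ih₁ (fun x hx ↦ h (Ideal.mem_sup_left hx))
    obtain ⟨c₂, hc₂, E₂, h₂⟩ := ih₂ (fun x hx ↦ h (Ideal.mem_sup_right hx))
    refine ⟨c₁ * c₂, mul_mem_Rcirc hc₁ hc₂, max E₁ E₂, fun e he ↦ ?_⟩
    rw [fbp_sup, Ideal.mul_sup, ← Ideal.span_singleton_mul_span_singleton]
    refine sup_le ?_ ?_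
    · rw [mul_comm (span {c₁}), mul_assoc]
      exact Ideal.mul_le_right.trans (h₁ e (le_of_max_le_left he))
    · rw [mul_assoc]
      exact Ideal.mul_le_right.trans (h₂ e (le_of_max_le_right he))

lemma pow_mem_mul_pow_of_mem_intCl {I J : Ideal R} (hIJ : I ≤ J) {x : R} (hx : x ∈ intCl I)
    (hxJ : x ∈ J) : ∃ m : ℕ, x ^ (m + 1) ∈ I * J ^ m := by
  obtain ⟨n, hn, r, hr, h⟩ := hx
  obtain ⟨m, rfl⟩ := Nat.exists_eq_succ_of_ne_zero hn.ne'
  refine ⟨m, ?_⟩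
  rw [Nat.succ_eq_add_one] at h hr
  rw [eq_neg_of_add_eq_zero_left h]
  refine neg_mem (sum_mem fun i hi ↦ ?_)
  have him : i ≤ m := Nat.lt_succ_iff.1 (Finset.mem_range.1 hi)
  have hle : I ^ (i + 1) * J ^ (m - i) ≤ I * J ^ m := calc
    I ^ (i + 1) * J ^ (m - i) = I * (I ^ i * J ^ (m - i)) := by rw [pow_succ', mul_assoc]
    _ ≤ I * (J ^ i * J ^ (m - i)) :=
      Ideal.mul_mono_right (Ideal.mul_mono_left (Ideal.pow_right_mono hIJ i))
    _ = I * J ^ m := by rw [← pow_add, Nat.add_sub_cancel' him]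
  rw [Nat.add_sub_add_right]
  exact hle (Ideal.mul_mem_mul (hr _ (by omega) (by omega)) (Ideal.pow_mem_pow hxJ _))

/-- A finitely generated ideal `K ≤ J` of elements integral over `I ≤ J` satisfies
`K ^ (m + 1) ≤ I * J ^ m` for some `m`. -/
lemma exists_pow_le_mul_pow_of_subset_intCl {I J K : Ideal R} (hIJ : I ≤ J) (hK : K.FG)
    (hKJ : K ≤ J) (h : (K : Set R) ⊆ intCl I) : ∃ m : ℕ, K ^ (m + 1) ≤ I * J ^ m := by
  induction K, hK using Submodule.fg_induction with
  | singleton x =>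
    obtain ⟨m, hm⟩ := pow_mem_mul_pow_of_mem_intCl hIJ (h (Ideal.mem_span_singleton_self x))
      (hKJ (Ideal.mem_span_singleton_self x))
    refine ⟨m, ?_⟩
    rw [Ideal.submodule_span_eq, Ideal.span_singleton_pow]
    exact (Ideal.span_singleton_le_iff_mem _).2 hm
  | sup K₁ K₂ _ _ ih₁ ih₂ =>
    have hK₁ : K₁ ≤ J := le_sup_left.trans hKJ
    have hK₂ : K₂ ≤ J := le_sup_right.trans hKJ
    obtain ⟨m₁, h₁⟩ := ih₁ hK₁ (fun x hx ↦ h (Ideal.mem_sup_left hx))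
    obtain ⟨m₂, h₂⟩ := ih₂ hK₂ (fun x hx ↦ h (Ideal.mem_sup_right hx))
    have key : ∀ {A B : Ideal R} {m i j : ℕ}, A ≤ J → B ≤ J → A ^ (m + 1) ≤ I * J ^ m →
        m + 1 ≤ i → i + j = m₁ + m₂ + 1 → A ^ i * B ^ j ≤ I * J ^ (m₁ + m₂) := by
      intro A B m i j hA hB hAm hi hij
      obtain ⟨k, rfl⟩ := Nat.exists_eq_add_of_le hi
      calc A ^ (m + 1 + k) * B ^ j = A ^ (m + 1) * (A ^ k * B ^ j) := by
            rw [pow_add, mul_assoc]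
        _ ≤ I * J ^ m * (J ^ k * J ^ j) :=
            Ideal.mul_mono hAm
              (Ideal.mul_mono (Ideal.pow_right_mono hA k) (Ideal.pow_right_mono hB j))
        _ = I * J ^ (m₁ + m₂) := by
            rw [mul_assoc, ← pow_add, ← pow_add]
            congr 2
            omega
    refine ⟨m₁ + m₂, ?_⟩
    rw [← Submodule.add_eq_sup, add_pow, Ideal.sum_eq_sup]
    refine Finset.sup_le fun i hi ↦ Ideal.mul_le_left.trans ?_
    have hi' := Finset.mem_range.1 hi
    rcases le_or_gt (m₁ + 1) i with hi₁ | hi₁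
    · exact key hK₁ hK₂ h₁ hi₁ (by omega)
    · rw [mul_comm]
      exact key hK₂ hK₁ h₂ (by omega) (by omega)

lemma pow_add_le_of_pow_succ_le {I J : Ideal R} {m : ℕ} (h : J ^ (m + 1) ≤ I * J ^ m) (n : ℕ) :
    J ^ (n + m) ≤ I ^ n * J ^ m := by
  induction n with
  | zero => simp
  | succ n ih => calc
      J ^ (n + 1 + m) = J * J ^ (n + m) := by rw [← pow_succ']; congr 1; omega
      _ ≤ J * (I ^ n * J ^ m) := Ideal.mul_mono_right ih
      _ = I ^ n * J ^ (m + 1) := by rw [pow_succ]; ring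
      _ ≤ I ^ n * (I * J ^ m) := Ideal.mul_mono_right h
      _ = I ^ (n + 1) * J ^ m := by rw [pow_succ]; ring

lemma exists_mul_pow_le_of_subset_intCl {I J : Ideal R} (hI : ∃ c ∈ Rcirc R, c ∈ I)
    (hIJ : I ≤ J) (hJ : J.FG) (h : (J : Set R) ⊆ intCl I) :
    ∃ c ∈ Rcirc R, ∀ n : ℕ, span {c} * J ^ n ≤ I ^ n := by
  obtain ⟨c, hc, hcI⟩ := hI
  obtain ⟨m, hm⟩ := exists_pow_le_mul_pow_of_subset_intCl hIJ hJ le_rfl h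
  refine ⟨c ^ m, pow_mem_Rcirc hc m, fun n ↦ ?_⟩
  calc span {c ^ m} * J ^ n ≤ J ^ m * J ^ n := Ideal.mul_mono_left
        ((Ideal.span_singleton_le_iff_mem _).2 (Ideal.pow_mem_pow (hIJ hcI) m))
    _ = J ^ (n + m) := by rw [← pow_add, add_comm]
    _ ≤ I ^ n * J ^ m := pow_add_le_of_pow_succ_le hm n
    _ ≤ I ^ n := Ideal.mul_le_left

lemma HYFrobCl_subset_of_fbp_le {p : ℕ} {I J : Ideal R}
    (h : ∃ E : ℕ, ∀ e, E ≤ e → fbp J (p ^ e) ≤ fbp I (p ^ e)) (a : Ideal R) (t : ℝ) :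
    HYFrobCl p J a t ⊆ HYFrobCl p I a t := by
  obtain ⟨E, hE⟩ := h
  rintro x ⟨E', hx⟩
  exact ⟨max E E', fun e he y hy ↦
    hE e (le_of_max_le_left he) (hx e (le_of_max_le_right he) y hy)⟩

lemma VFrobCl_subset_of_fbp_le {p : ℕ} {I J : Ideal R}
    (h : ∃ E : ℕ, ∀ e, E ≤ e → fbp J (p ^ e) ≤ fbp I (p ^ e)) (a : Ideal R) (t : ℝ) :
    VFrobCl p J a t ⊆ VFrobCl p I a t := by
  obtain ⟨E, hE⟩ := h
  rintro x ⟨E', hx⟩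
  exact ⟨max E E', fun e he y hy ↦ Ideal.mul_mono_right
    (hE e (le_of_max_le_left he)) (hx e (le_of_max_le_right he) y hy)⟩

lemma HYTightCl_subset_of_mul_fbp_le {p : ℕ} {I J : Ideal R}
    (h : ∃ c ∈ Rcirc R, ∃ E : ℕ, ∀ e, E ≤ e → span {c} * fbp J (p ^ e) ≤ fbp I (p ^ e))
    (a : Ideal R) (t : ℝ) : HYTightCl p J a t ⊆ HYTightCl p I a t := by
  obtain ⟨c, hc, E, hE⟩ := h
  rintro x ⟨d, hd, E', hx⟩
  refine ⟨c * d, mul_mem_Rcirc hc hd, max E E', fun e he y hy ↦ ?_⟩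
  rw [mul_assoc c, mul_assoc c]
  exact hE e (le_of_max_le_left he) (Ideal.mul_mem_mul (Ideal.mem_span_singleton_self c)
    (hx e (le_of_max_le_right he) y hy))

lemma VTightCl_subset_of_mul_fbp_le {p : ℕ} {I J : Ideal R}
    (h : ∃ c ∈ Rcirc R, ∃ E : ℕ, ∀ e, E ≤ e → span {c} * fbp J (p ^ e) ≤ fbp I (p ^ e))
    (a : Ideal R) (t : ℝ) : VTightCl p J a t ⊆ VTightCl p I a t := by
  obtain ⟨c, hc, E, hE⟩ := h
  rintro x ⟨d, hd, E', hx⟩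
  refine ⟨c * d, mul_mem_Rcirc hc hd, max E E', fun e he y hy ↦ ?_⟩
  have hmem := Ideal.mul_mem_mul (Ideal.mem_span_singleton_self c)
    (hx e (le_of_max_le_right he) y hy)
  rw [mul_left_comm (span {c})] at hmem
  rw [mul_assoc c, mul_assoc c]
  exact Ideal.mul_mono_right (hE e (le_of_max_le_left he)) hmem

lemma HYIntCl_subset_of_mul_pow_le {I J : Ideal R}
    (h : ∃ c ∈ Rcirc R, ∀ n : ℕ, span {c} * J ^ n ≤ I ^ n) (a : Ideal R) (t : ℝ) :
    HYIntCl J a t ⊆ HYIntCl I a t := by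
  obtain ⟨c, hc, h⟩ := h
  rintro x ⟨d, hd, N, hx⟩
  refine ⟨c * d, mul_mem_Rcirc hc hd, N, fun n hn y hy ↦ ?_⟩
  rw [mul_assoc c, mul_assoc c]
  exact h n (Ideal.mul_mem_mul (Ideal.mem_span_singleton_self c) (hx n hn y hy))

end AdjustedClosures

theorem adjusted_closures_of_closures {R : Type*} [CommRing R] [IsNoetherianRing R]
    (p : ℕ) [Fact p.Prime] [CharP R p] (I a : Ideal R)
    (hI : ∃ c ∈ Rcirc R, c ∈ I) (ha : ∃ c ∈ Rcirc R, c ∈ a) (t : ℝ) (ht : 0 < t) :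
    (∀ J : Ideal R, (J : Set R) = frobCl p I →
      HYFrobCl p J a t = HYFrobCl p I a t ∧ VFrobCl p J a t = VFrobCl p I a t) ∧
    (∀ J : Ideal R, (J : Set R) = tightCl p I →
      HYTightCl p J a t = HYTightCl p I a t ∧ VTightCl p J a t = VTightCl p I a t) ∧
    (∀ J : Ideal R, (J : Set R) = intCl I → HYIntCl J a t = HYIntCl I a t) := by
  have : ExpChar R p := ExpChar.prime Fact.out
  refine ⟨fun J hJ ↦ ?_, fun J hJ ↦ ?_, fun J hJ ↦ ?_⟩
  · have hIJ : I ≤ J := (subset_frobCl p I).trans hJ.ge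
    have hle := exists_fbp_le_of_subset_frobCl p (IsNoetherian.noetherian J) hJ.le
    have hge : ∃ E : ℕ, ∀ e, E ≤ e → fbp I (p ^ e) ≤ fbp J (p ^ e) :=
      ⟨0, fun e _ ↦ fbp_mono hIJ _⟩
    exact ⟨(HYFrobCl_subset_of_fbp_le hle a t).antisymm (HYFrobCl_subset_of_fbp_le hge a t),
      (VFrobCl_subset_of_fbp_le hle a t).antisymm (VFrobCl_subset_of_fbp_le hge a t)⟩
  · have hIJ : I ≤ J := (subset_tightCl p I).trans hJ.ge
    have hle := exists_mul_fbp_le_of_subset_tightCl p (IsNoetherian.noetherian J) hJ.le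
    have hge : ∃ c ∈ Rcirc R, ∃ E : ℕ, ∀ e, E ≤ e →
        span {c} * fbp I (p ^ e) ≤ fbp J (p ^ e) :=
      ⟨1, one_mem_Rcirc, 0, fun e _ ↦ Ideal.mul_le_right.trans (fbp_mono hIJ _)⟩
    exact ⟨(HYTightCl_subset_of_mul_fbp_le hle a t).antisymm
        (HYTightCl_subset_of_mul_fbp_le hge a t),
      (VTightCl_subset_of_mul_fbp_le hle a t).antisymm (VTightCl_subset_of_mul_fbp_le hge a t)⟩
  · have hIJ : I ≤ J := (subset_intCl I).trans hJ.ge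
    have hle := exists_mul_pow_le_of_subset_intCl hI hIJ (IsNoetherian.noetherian J) hJ.le
    have hge : ∃ c ∈ Rcirc R, ∀ n : ℕ, span {c} * I ^ n ≤ J ^ n :=
      ⟨1, one_mem_Rcirc, fun n ↦ Ideal.mul_le_right.trans (Ideal.pow_right_mono hIJ n)⟩
    exact (HYIntCl_subset_of_mul_pow_le hle a t).antisymm (HYIntCl_subset_of_mul_pow_le hge a t)
end

section
/- Let k be a field, let σ^∨ = {v ∈ ℝ^d : ⟨cᵢ, v⟩ ≥ 0 for i = 1,…,n} for given c₁,…,cₙ ∈ ℤ^d, let S = σ^∨ ∩ ℤ^d (assumed to generate ℤ^d as a group), and let R = k[S] be the monoid algebra with monomials x^v for v ∈ S. Let 𝒜, ℬ ⊆ S be finite, 𝔞 = (x^a : a ∈ 𝒜), I = (x^b : b ∈ ℬ), H the convex hull of 𝒜 in ℝ^d, and t > 0 a real number. Then for v ∈ S, the monomial x^v lies in the Hara–Yoshida 𝔞ᵗ-integral closure Ī^{𝔞ᵗ} if and only if v + tH is contained in the convex hull (in ℝ^d) of Exp(I) = {u ∈ S : x^u ∈ I}. -/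
open Ideal Filter
open scoped Pointwise

/-- Coordinatewise embedding `ℤ^d → ℝ^d`. -/
def castR {d : ℕ} (v : Fin d → ℤ) : Fin d → ℝ := fun j => (v j : ℝ)

/-- The affine semigroup `S = σ^∨ ∩ ℤ^d` of lattice points of the cone cut out by the `cᵢ`. -/
def latticePoints {d n : ℕ} (c : Fin n → Fin d → ℤ) : AddSubmonoid (Fin d → ℤ) where
  carrier := {v | ∀ i, 0 ≤ ∑ j, c i j * v j}
  zero_mem' := by intro i; simp
  add_mem' := by
    intro a b ha hb i
    have h := add_nonneg (ha i) (hb i)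
    simpa [mul_add, Finset.sum_add_distrib] using h

/-- The inclusion of the affine semigroup into `ℝ^d`, as an additive homomorphism. -/
def latticeEmb {d n : ℕ} (c : Fin n → Fin d → ℤ) : ↥(latticePoints c) →+ (Fin d → ℝ) where
  toFun u := castR (u : Fin d → ℤ)
  map_zero' := by ext; simp [castR]
  map_add' x y := by ext; simp [castR]

lemma latticeEmb_injective {d n : ℕ} (c : Fin n → Fin d → ℤ) :
    Function.Injective (latticeEmb c) := by
  intro x y h
  ext j
  have := congrFun h j
  simpa [latticeEmb, castR] using this

/-- The real polyhedral cone cut out by the `cᵢ`. -/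
def realCone {d n : ℕ} (c : Fin n → Fin d → ℤ) : AddSubmonoid (Fin d → ℝ) where
  carrier := {x | ∀ i, 0 ≤ ∑ j, (c i j : ℝ) * x j}
  zero_mem' := by intro i; simp
  add_mem' := by
    intro a b ha hb i
    have h := add_nonneg (ha i) (hb i)
    simpa [mul_add, Finset.sum_add_distrib] using h

lemma mem_realCone {d n : ℕ} {c : Fin n → Fin d → ℤ} {x : Fin d → ℝ} :
    x ∈ realCone c ↔ ∀ i, 0 ≤ ∑ j, (c i j : ℝ) * x j := Iff.rfl

lemma smul_mem_realCone {d n : ℕ} {c : Fin n → Fin d → ℤ} {x : Fin d → ℝ} {r : ℝ}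
    (hr : 0 ≤ r) (hx : x ∈ realCone c) : r • x ∈ realCone c := by
  intro i
  have h := mul_nonneg hr (hx i)
  simpa [Finset.mul_sum, mul_left_comm] using h

lemma convex_realCone {d n : ℕ} (c : Fin n → Fin d → ℤ) :
    Convex ℝ (realCone c : Set (Fin d → ℝ)) := fun _ hx _ hy _ _ ha hb _ =>
  add_mem (smul_mem_realCone ha hx) (smul_mem_realCone hb hy)

lemma isClosed_realCone {d n : ℕ} (c : Fin n → Fin d → ℤ) :
    IsClosed (realCone c : Set (Fin d → ℝ)) := by
  have : (realCone c : Set (Fin d → ℝ)) = ⋂ i, {x | 0 ≤ ∑ j, (c i j : ℝ) * x j} := by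
    ext x; simp [mem_realCone]
  rw [this]
  exact isClosed_iInter fun i => isClosed_le continuous_const (by fun_prop)

lemma castR_mem_realCone_iff {d n : ℕ} {c : Fin n → Fin d → ℤ} {z : Fin d → ℤ} :
    castR z ∈ realCone c ↔ z ∈ latticePoints c := by
  refine forall_congr' fun i => ?_
  simp only [castR]
  exact_mod_cast Iff.rfl

lemma latticeEmb_mem_realCone {d n : ℕ} {c : Fin n → Fin d → ℤ} (u : ↥(latticePoints c)) :
    latticeEmb c u ∈ realCone c :=
  castR_mem_realCone_iff.2 u.2

/-- Rational points of the cone lie in the convex hull of its lattice points. -/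
lemma rat_mem_convexHull_range {d n : ℕ} {c : Fin n → Fin d → ℤ} (z : Fin d → ℚ)
    (hz : (fun j => (z j : ℝ)) ∈ realCone c) :
    (fun j => (z j : ℝ)) ∈ convexHull ℝ (Set.range (latticeEmb c)) := by
  set D : ℕ := ∏ j, (z j).den with hD
  have hDpos : 0 < D := Finset.prod_pos fun j _ => (z j).den_pos
  have hint : ∀ j, ∃ m : ℤ, (m : ℚ) = D * z j := by
    intro j
    obtain ⟨e, he⟩ := Finset.dvd_prod_of_mem (fun j => (z j).den) (Finset.mem_univ j)
    refine ⟨e * (z j).num, ?_⟩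
    rw [hD, he]
    push_cast
    rw [← Rat.mul_den_eq_num (z j)]
    ring
  choose m hm using hint
  have hcast : castR m = (D : ℝ) • fun j => (z j : ℝ) := by
    ext j
    simp only [castR, Pi.smul_apply, smul_eq_mul]
    exact_mod_cast hm j
  have hmem : m ∈ latticePoints c := by
    rw [← castR_mem_realCone_iff, hcast]
    exact smul_mem_realCone (by positivity) hz
  have hDr : (1 : ℝ) ≤ D := by exact_mod_cast hDpos
  have h0 : (0 : Fin d → ℝ) ∈ convexHull ℝ (Set.range (latticeEmb c)) :=
    subset_convexHull _ _ ⟨0, map_zero _⟩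
  have h1 : castR m ∈ convexHull ℝ (Set.range (latticeEmb c)) :=
    subset_convexHull _ _ ⟨⟨m, hmem⟩, rfl⟩
  have h := (convex_convexHull ℝ _).smul_mem_of_zero_mem h0 h1
    (t := (D : ℝ)⁻¹) ⟨by positivity, inv_le_one_of_one_le₀ hDr⟩
  rwa [hcast, smul_smul, inv_mul_cancel₀ (by positivity), one_smul] at h

/-- The rational cone is contained in the convex hull of its lattice points. -/
lemma realCone_subset_convexHull {d n : ℕ} (c : Fin n → Fin d → ℤ) :
    (realCone c : Set (Fin d → ℝ)) ⊆ convexHull ℝ (Set.range (latticeEmb c)) := by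
  intro s hs
  let W := Submodule.span ℚ (Set.range s)
  have : FiniteDimensional ℚ W := FiniteDimensional.span_of_finite ℚ (Set.finite_range s)
  let b := Module.finBasis ℚ W
  set r := Module.finrank ℚ W
  let ω : Fin r → ℝ := fun l => (b l : ℝ)
  let q : Fin d → Fin r → ℚ := fun j l => b.repr ⟨s j, Submodule.subset_span ⟨j, rfl⟩⟩ l
  have hsq : ∀ j, s j = ∑ l, (q j l : ℝ) * ω l := by
    intro j
    have h := congrArg (Subtype.val) (b.sum_repr ⟨s j, Submodule.subset_span ⟨j, rfl⟩⟩)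
    simp only [Submodule.coe_sum, Submodule.coe_smul, Rat.smul_def] at h
    exact h.symm
  let L : Fin n → Fin r → ℚ := fun i l => ∑ j, c i j * q j l
  let f : (Fin r → ℝ) →ₗ[ℝ] (Fin d → ℝ) := Matrix.mulVecLin (fun j l => (q j l : ℝ))
  have hf : ∀ x j, f x j = ∑ l, (q j l : ℝ) * x l := fun x j => rfl
  have hLf : ∀ x i, ∑ j, (c i j : ℝ) * f x j = ∑ l, (L i l : ℝ) * x l := by
    intro x i
    simp only [hf, L, Finset.mul_sum, Rat.cast_sum, Finset.sum_mul, Rat.cast_mul, Rat.cast_intCast]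
    rw [Finset.sum_comm]
    simp only [mul_assoc]
  have hfω : f ω = s := funext fun j => (hsq j).symm
  have hind : LinearIndependent ℚ ω :=
    b.linearIndependent.map' W.subtype (Submodule.ker_subtype _)
  let U : Set (Fin r → ℝ) := ⋂ i, {x | (∀ l, L i l = 0) ∨ 0 < ∑ l, (L i l : ℝ) * x l}
  have hU : IsOpen U := by
    refine isOpen_iInter_of_finite fun i => ?_
    rw [Set.ofPred_or]
    exact isOpen_const.union (isOpen_lt continuous_const (by fun_prop))
  have hωU : ω ∈ U := by
    refine Set.mem_iInter.2 fun i => ?_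
    have h := hs i
    rw [← hfω, hLf] at h
    rcases h.eq_or_lt with h0 | h0
    · left
      refine Fintype.linearIndependent_iff.1 hind (L i) ?_
      simpa [Rat.smul_def] using h0.symm
    · exact Or.inr h0
  have hUcone : ∀ x ∈ U, f x ∈ realCone c := by
    intro x hx i
    rw [hLf]
    rcases Set.mem_iInter.1 hx i with h | h
    · simp [h]
    · exact h.le
  obtain ⟨ε, hε, hball⟩ := Metric.isOpen_iff.1 hU ω hωU
  have hlo : ∀ l, ∃ p : ℚ, ω l - ε < p ∧ (p : ℝ) < ω l := fun l => exists_rat_btwn (by linarith)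
  have hhi : ∀ l, ∃ p : ℚ, ω l < p ∧ (p : ℝ) < ω l + ε := fun l => exists_rat_btwn (by linarith)
  choose lo hlo1 hlo2 using hlo
  choose hi hhi1 hhi2 using hhi
  let V : Set (Fin r → ℝ) := Set.univ.pi fun l => {(lo l : ℝ), (hi l : ℝ)}
  have hωV : ω ∈ convexHull ℝ V := by
    rw [convexHull_pi]
    intro l _
    beta_reduce
    rw [convexHull_pair, segment_eq_Icc ((hlo2 l).le.trans (hhi1 l).le)]
    exact ⟨(hlo2 l).le, (hhi1 l).le⟩
  have hs' : s ∈ convexHull ℝ (f '' V) := by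
    rw [← LinearMap.image_convexHull]
    exact ⟨ω, hωV, hfω⟩
  refine convexHull_min ?_ (convex_convexHull ℝ _) hs'
  rintro _ ⟨x, hx, rfl⟩
  have hxq : ∀ l, ∃ p : ℚ, (p : ℝ) = x l := by
    intro l
    rcases hx l (Set.mem_univ l) with h | h
    exacts [⟨_, h.symm⟩, ⟨_, h.symm⟩]
  choose p hp using hxq
  have hxU : x ∈ U := by
    refine hball ?_
    rw [Metric.mem_ball, dist_pi_lt_iff hε]
    intro l
    rw [Real.dist_eq, abs_lt]
    rcases hx l (Set.mem_univ l) with h | h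
    · rw [h]; constructor <;> linarith [hlo1 l, hlo2 l]
    · rw [Set.mem_singleton_iff.1 h]; constructor <;> linarith [hhi1 l, hhi2 l]
  have hfx : f x = fun j => ((∑ l, q j l * p l : ℚ) : ℝ) := by
    ext j
    simp [hf, hp]
  rw [hfx]
  refine rat_mem_convexHull_range _ ?_
  rw [← hfx]
  exact hUcone x hxU

/-- Sums of `m` elements of `X`, with repetition. -/
def sumset {S : Type*} [AddCommMonoid S] (X : Set S) (m : ℕ) : Set S :=
  {u | ∃ M : Multiset S, M.card = m ∧ (∀ x ∈ M, x ∈ X) ∧ M.sum = u}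

lemma of'_mul_of' {k S : Type*} [Field k] [AddCommMonoid S] (x y : S) :
    AddMonoidAlgebra.of' k S x * AddMonoidAlgebra.of' k S y =
      AddMonoidAlgebra.of' k S (x + y) := by
  simp [AddMonoidAlgebra.single_mul_single]

lemma of'_pow {k S : Type*} [Field k] [AddCommMonoid S] (x : S) (n : ℕ) :
    AddMonoidAlgebra.of' k S x ^ n = AddMonoidAlgebra.of' k S (n • x) := by
  simp [AddMonoidAlgebra.single_pow]

lemma span_of'_pow {k S : Type*} [Field k] [AddCommMonoid S] (X : Set S) (m : ℕ) :
    Ideal.span (AddMonoidAlgebra.of' k S '' X) ^ m =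
      Ideal.span (AddMonoidAlgebra.of' k S '' sumset X m) := by
  induction m with
  | zero =>
    have : sumset X 0 = {0} := by
      ext u
      simp [sumset, Multiset.card_eq_zero, eq_comm]
    rw [this, pow_zero, Set.image_singleton, Ideal.one_eq_top, eq_comm]
    exact Ideal.span_singleton_one
  | succ m ih =>
    rw [pow_succ, ih, Ideal.span_mul_span']
    congr 1
    ext y
    constructor
    · rintro ⟨_, ⟨u, ⟨M, hM, hX, rfl⟩, rfl⟩, _, ⟨x, hx, rfl⟩, rfl⟩
      refine ⟨x + M.sum, ⟨x ::ₘ M, by simp [hM], by simpa using ⟨hx, hX⟩, by simp⟩, ?_⟩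
      rw [add_comm]
      exact (of'_mul_of' _ _).symm
    · rintro ⟨u, ⟨M, hM, hX, rfl⟩, rfl⟩
      obtain ⟨x, hx⟩ := Multiset.card_pos_iff_exists_mem.1 (hM.symm ▸ m.succ_pos : 0 < M.card)
      obtain ⟨M, rfl⟩ := Multiset.exists_cons_of_mem hx
      rw [Multiset.forall_mem_cons] at hX
      refine ⟨_, ⟨M.sum, ⟨M, by simpa using hM, hX.2, rfl⟩, rfl⟩, _, ⟨x, hX.1, rfl⟩, ?_⟩
      simp only [Multiset.sum_cons]
      rw [add_comm x]
      exact of'_mul_of' _ _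

lemma of'_mem_span_iff {k S : Type*} [Field k] [AddCommMonoid S] {X : Set S} {u : S} :
    AddMonoidAlgebra.of' k S u ∈ Ideal.span (AddMonoidAlgebra.of' k S '' X) ↔
      ∃ x ∈ X, ∃ e, u = e + x := by
  rw [AddMonoidAlgebra.mem_ideal_span_of'_image]
  simp [AddMonoidAlgebra.of'_apply]

lemma map_sumset_mem {S E : Type*} [AddCommMonoid S] [AddCommGroup E] [Module ℝ E]
    (φ : S →+ E) {X : Set S} (hX : X.Nonempty) {m : ℕ} {u : S} (hu : u ∈ sumset X m) :
    φ u ∈ (m : ℝ) • convexHull ℝ (φ '' X) := by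
  obtain ⟨M, rfl, hM, rfl⟩ := hu
  have hne : (convexHull ℝ (φ '' X)).Nonempty := (hX.image φ).convexHull
  induction M using Multiset.induction with
  | empty => simp [Set.zero_smul_set hne]
  | cons x M ih =>
    rw [Multiset.forall_mem_cons] at hM
    simp only [Multiset.card_cons, Multiset.sum_cons, map_add, Nat.cast_add, Nat.cast_one]
    rw [(convex_convexHull ℝ _).add_smul (Nat.cast_nonneg _) zero_le_one, one_smul, add_comm (φ x)]
    exact Set.add_mem_add (ih hM.2) (subset_convexHull ℝ _ ⟨x, hM.1, rfl⟩)

/-- The Newton polyhedron of a monomial ideal is the convex hull of its generating exponents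
plus the cone. -/
lemma convexHull_exponents_eq {d n : ℕ} (k : Type*) [Field k] (c : Fin n → Fin d → ℤ)
    (X : Set ↥(latticePoints c)) :
    convexHull ℝ (latticeEmb c '' {u | AddMonoidAlgebra.of' k ↥(latticePoints c) u ∈
      Ideal.span (AddMonoidAlgebra.of' k ↥(latticePoints c) '' X)}) =
    convexHull ℝ (latticeEmb c '' X) + (realCone c : Set (Fin d → ℝ)) := by
  have hset : latticeEmb c '' {u | AddMonoidAlgebra.of' k ↥(latticePoints c) u ∈
      Ideal.span (AddMonoidAlgebra.of' k ↥(latticePoints c) '' X)} =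
      latticeEmb c '' X + Set.range (latticeEmb c) := by
    ext y
    constructor
    · rintro ⟨u, hu, rfl⟩
      obtain ⟨x, hx, e, rfl⟩ := of'_mem_span_iff.1 hu
      exact ⟨_, ⟨x, hx, rfl⟩, _, ⟨e, rfl⟩, by simp [add_comm]⟩
    · rintro ⟨_, ⟨x, hx, rfl⟩, _, ⟨e, rfl⟩, rfl⟩
      exact ⟨e + x, of'_mem_span_iff.2 ⟨x, hx, e, rfl⟩, by simp [add_comm]⟩
  have hcone : convexHull ℝ (Set.range (latticeEmb c)) = (realCone c : Set (Fin d → ℝ)) :=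
    (convexHull_min (Set.range_subset_iff.2 latticeEmb_mem_realCone)
      (convex_realCone c)).antisymm (realCone_subset_convexHull c)
  rw [hset, convexHull_add, hcone]

instance isDomain_latticeAlgebra {d n : ℕ} (k : Type*) [Field k] (c : Fin n → Fin d → ℤ) :
    IsDomain (AddMonoidAlgebra k ↥(latticePoints c)) := by
  have : UniqueSums ↥(latticePoints c) :=
    UniqueSums.of_injective_addHom ((latticePoints c).subtype : _ →ₙ+ (Fin d → ℤ))
      Subtype.val_injective inferInstance
  infer_instance

lemma mem_Rcirc_iff {R : Type*} [CommRing R] [IsDomain R] {x : R} : x ∈ Rcirc R ↔ x ≠ 0 := by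
  simp [Rcirc, IsDomain.minimalPrimes_eq_singleton_bot]

lemma of'_ne_zero {k S : Type*} [Field k] (x : S) : AddMonoidAlgebra.of' k S x ≠ 0 := by
  simp [AddMonoidAlgebra.of'_apply]

/-- If `x^v` lies in the `𝔞^t`-integral closure, then `v + t a` lies in the Newton polyhedron
for each generating exponent `a` of `𝔞`. -/
lemma add_smul_mem_of_mem_HYIntCl {d n : ℕ} {k : Type*} [Field k] {c : Fin n → Fin d → ℤ}
    {A B : Set ↥(latticePoints c)} (hB : B.Finite) {t : ℝ} (ht : 0 < t) {v : ↥(latticePoints c)}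
    (hv : AddMonoidAlgebra.of' k ↥(latticePoints c) v ∈
      HYIntCl (Ideal.span (AddMonoidAlgebra.of' k ↥(latticePoints c) '' B))
        (Ideal.span (AddMonoidAlgebra.of' k ↥(latticePoints c) '' A)) t)
    {u : ↥(latticePoints c)} (hu : u ∈ A) :
    latticeEmb c v + t • latticeEmb c u ∈
      convexHull ℝ (latticeEmb c '' B) + (realCone c : Set (Fin d → ℝ)) := by
  obtain ⟨f, hf, N, hN⟩ := hv
  rw [mem_Rcirc_iff] at hf
  obtain ⟨w, hw⟩ : f.coeff.support.Nonempty := by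
    rw [Finsupp.support_nonempty_iff]
    simpa using hf
  have hclosed : IsClosed (convexHull ℝ (latticeEmb c '' B) +
      (realCone c : Set (Fin d → ℝ))) :=
    (isClosed_realCone c).add_left_of_isCompact (Set.Finite.isCompact_convexHull (𝕜 := ℝ) (hB.image _))
  have hlim : Tendsto (fun m : ℕ => (m : ℝ)⁻¹ • latticeEmb c w + latticeEmb c v +
      ((⌈t * (m : ℝ)⌉₊ : ℝ) / m) • latticeEmb c u) atTop
      (nhds (latticeEmb c v + t • latticeEmb c u)) := by
    have h1 : Tendsto (fun m : ℕ => (m : ℝ)⁻¹ • latticeEmb c w) atTop (nhds 0) := by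
      simpa using (tendsto_inv_atTop_nhds_zero_nat (𝕜 := ℝ)).smul_const (latticeEmb c w)
    have h2 : Tendsto (fun m : ℕ => (⌈t * (m : ℝ)⌉₊ : ℝ) / m) atTop (nhds t) :=
      (tendsto_nat_ceil_mul_div_atTop ht.le).comp tendsto_natCast_atTop_atTop
    simpa using (h1.add_const (latticeEmb c v)).add (h2.smul_const (latticeEmb c u))
  refine hclosed.mem_of_tendsto hlim ?_
  filter_upwards [eventually_ge_atTop N, eventually_gt_atTop 0] with m hmN hm0
  have hmem := hN m hmN (AddMonoidAlgebra.of' k _ u ^ ⌈t * (m : ℝ)⌉₊)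
    (Ideal.pow_mem_pow (Ideal.subset_span (Set.mem_image_of_mem _ hu)) _)
  rw [of'_pow, of'_pow, mul_assoc, of'_mul_of', span_of'_pow,
    AddMonoidAlgebra.mem_ideal_span_of'_image] at hmem
  obtain ⟨x, hx, e, he⟩ := hmem (w + (m • v + ⌈t * (m : ℝ)⌉₊ • u)) (by
    rw [AddMonoidAlgebra.of'_apply,
      AddMonoidAlgebra.support_coeff_mul_single _ _ (by simp)]
    exact Finset.mem_map.2 ⟨w, hw, rfl⟩)
  have hBne : B.Nonempty := by
    obtain ⟨M, hM, hMB, -⟩ := hx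
    obtain ⟨b, hb⟩ := Multiset.card_pos_iff_exists_mem.1 (hM ▸ hm0)
    exact ⟨b, hMB b hb⟩
  obtain ⟨p, hp, hpx⟩ := map_sumset_mem (latticeEmb c) hBne hx
  have hmr : (m : ℝ) ≠ 0 := by positivity
  refine ⟨p, hp, (m : ℝ)⁻¹ • latticeEmb c e,
    smul_mem_realCone (by positivity) (latticeEmb_mem_realCone e), ?_⟩
  have he' := congrArg (latticeEmb c) he
  simp only [map_add, map_nsmul, ← hpx, ← Nat.cast_smul_eq_nsmul ℝ] at he'
  have h := congrArg ((m : ℝ)⁻¹ • ·) he'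
  simp only [smul_add, smul_smul, inv_mul_cancel₀ hmr, one_smul] at h
  simp only [div_eq_inv_mul]
  rw [add_comm p, ← h, add_assoc]

/-- Rounding down the coefficients of a point in the `m`-fold dilate of the Newton polyhedron costs
only a bounded multiple of a fixed generating exponent. -/
lemma exists_sumset_add {d n : ℕ} {c : Fin n → Fin d → ℤ} {B : Finset ↥(latticePoints c)}
    {b₀ : ↥(latticePoints c)} (hb₀ : b₀ ∈ B) (m : ℕ) (u : ↥(latticePoints c))
    {p s : Fin d → ℝ} (hp : p ∈ convexHull ℝ (latticeEmb c '' (B : Set ↥(latticePoints c))))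
    (hs : s ∈ realCone c) (hu : latticeEmb c u = (m : ℝ) • p + s) :
    ∃ x ∈ sumset (B : Set ↥(latticePoints c)) m, ∃ e, B.card • b₀ + u = e + x := by
  classical
  rw [← Finset.coe_image, Finset.mem_convexHull'] at hp
  obtain ⟨w', hw0, hw1, hwp⟩ := hp
  rw [Finset.sum_image (latticeEmb_injective c).injOn] at hw1 hwp
  set w : ↥(latticePoints c) → ℝ := fun b => w' (latticeEmb c b)
  have hw0 : ∀ b ∈ B, 0 ≤ m * w b := fun b hb =>
    mul_nonneg m.cast_nonneg (hw0 _ (Finset.mem_image_of_mem _ hb))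
  let g : ↥(latticePoints c) → ℕ := fun b => ⌊m * w b⌋₊
  have hg : ∀ b ∈ B, (g b : ℝ) ≤ m * w b := fun b hb => Nat.floor_le (hw0 b hb)
  have hg' : ∀ b, m * w b ≤ g b + 1 := fun b => (Nat.lt_floor_add_one _).le
  have hsumw : ∑ b ∈ B, m * w b = m := by rw [← Finset.mul_sum, hw1, mul_one]
  have hle : ∑ b ∈ B, g b ≤ m := by
    have := Finset.sum_le_sum hg
    rw [hsumw] at this
    exact_mod_cast this
  obtain ⟨r, hr⟩ := Nat.exists_eq_add_of_le hle
  have hrB : r ≤ B.card := by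
    have := Finset.sum_le_sum fun b (_ : b ∈ B) => hg' b
    rw [hsumw, Finset.sum_add_distrib] at this
    simp only [Finset.sum_const, nsmul_eq_mul, mul_one] at this
    have h2 : m ≤ ∑ b ∈ B, g b + B.card := by exact_mod_cast this
    omega
  let x : ↥(latticePoints c) := ∑ b ∈ B, g b • b + r • b₀
  have hx : x ∈ sumset (B : Set ↥(latticePoints c)) m := by
    refine ⟨∑ b ∈ B, Multiset.replicate (g b) b + Multiset.replicate r b₀, ?_, ?_, ?_⟩
    · simp [hr]
    · intro y hy
      rcases Multiset.mem_add.1 hy with hy | hy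
      · obtain ⟨b, hb, hy⟩ := Multiset.mem_sum.1 hy
        rw [Multiset.eq_of_mem_replicate hy]
        exact hb
      · rw [Multiset.eq_of_mem_replicate hy]
        exact hb₀
    · simp [x, Multiset.sum_sum]
  have hxE : latticeEmb c x = ∑ b ∈ B, (g b : ℝ) • latticeEmb c b + (r : ℝ) • latticeEmb c b₀ := by
    simp [x, Nat.cast_smul_eq_nsmul]
  let z : Fin d → ℤ := ((B.card • b₀ + u : ↥(latticePoints c)) : Fin d → ℤ) - (x : Fin d → ℤ)
  have hzE : castR z = ∑ b ∈ B, (m * w b - g b) • latticeEmb c b +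
      ((B.card : ℝ) - r) • latticeEmb c b₀ + s := by
    have : castR z = latticeEmb c (B.card • b₀ + u) - latticeEmb c x := by
      ext j; simp [z, latticeEmb, castR]
    rw [this, map_add, map_nsmul, hu, hxE, ← hwp, Finset.smul_sum]
    simp only [sub_smul, Finset.sum_sub_distrib, smul_smul, Nat.cast_smul_eq_nsmul, w]
    abel
  have hz : z ∈ latticePoints c := by
    rw [← castR_mem_realCone_iff, hzE]
    refine add_mem (add_mem (sum_mem fun b hb => ?_) ?_) hs
    · exact smul_mem_realCone (sub_nonneg.2 (hg b hb)) (latticeEmb_mem_realCone b)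
    · exact smul_mem_realCone (sub_nonneg.2 (by exact_mod_cast hrB)) (latticeEmb_mem_realCone b₀)
  exact ⟨x, hx, ⟨z, hz⟩, Subtype.ext (sub_add_cancel _ _).symm⟩

/-- If `v + t H` lies in the Newton polyhedron, then `x^v` lies in the `𝔞^t`-integral
closure. -/
lemma of'_mem_HYIntCl {d n : ℕ} {k : Type*} [Field k] {c : Fin n → Fin d → ℤ}
    {A : Set ↥(latticePoints c)} {B : Finset ↥(latticePoints c)} {t : ℝ} (ht : 0 < t)
    {v : ↥(latticePoints c)}
    (h : ∀ p ∈ convexHull ℝ (latticeEmb c '' A), latticeEmb c v + t • p ∈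
      convexHull ℝ (latticeEmb c '' (B : Set ↥(latticePoints c))) +
        (realCone c : Set (Fin d → ℝ))) :
    AddMonoidAlgebra.of' k ↥(latticePoints c) v ∈
      HYIntCl (Ideal.span (AddMonoidAlgebra.of' k ↥(latticePoints c) ''
          (B : Set ↥(latticePoints c))))
        (Ideal.span (AddMonoidAlgebra.of' k ↥(latticePoints c) '' A)) t := by
  rcases A.eq_empty_or_nonempty with rfl | hA
  · refine ⟨1, mem_Rcirc_iff.2 one_ne_zero, 1, fun m hm y hy => ?_⟩
    have hpos : ⌈t * (m : ℝ)⌉₊ ≠ 0 := by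
      have : (0 : ℝ) < m := by exact_mod_cast hm
      exact (Nat.ceil_pos.2 (by positivity)).ne'
    rw [Set.image_empty, Ideal.span_empty, ← Ideal.zero_eq_bot, zero_pow hpos] at hy
    have hy0 : y = 0 := by simpa using hy
    simp [hy0]
  obtain ⟨b₀, hb₀⟩ : (B : Set ↥(latticePoints c)).Nonempty := by
    obtain ⟨q, hq⟩ := (hA.image (latticeEmb c)).convexHull (𝕜 := ℝ)
    obtain ⟨p, hp, -⟩ := h q hq
    exact (convexHull_nonempty_iff.1 ⟨p, hp⟩).of_image
  refine ⟨AddMonoidAlgebra.of' k _ (B.card • b₀), mem_Rcirc_iff.2 (of'_ne_zero _), 1,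
    fun m hm y hy => ?_⟩
  have hm0 : (0 : ℝ) < m := by exact_mod_cast hm
  rw [span_of'_pow] at hy ⊢
  refine Submodule.span_induction ?_ (by simp) (fun y z _ _ hy hz => ?_)
    (fun r y _ hy => ?_) hy
  · rintro _ ⟨u, hu, rfl⟩
    rw [of'_pow, of'_mul_of', of'_mul_of', of'_mem_span_iff]
    obtain ⟨q, hq, hqu⟩ := map_sumset_mem (latticeEmb c) hA hu
    obtain ⟨p, hp, s, hs, hps⟩ := h q hq
    have hqcone : q ∈ realCone c :=
      convexHull_min (Set.image_subset_iff.2 fun a _ => latticeEmb_mem_realCone a)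
        (convex_realCone c) hq
    rw [add_assoc]
    refine exists_sumset_add hb₀ m (m • v + u) hp
      (s := (m : ℝ) • s + ((⌈t * (m : ℝ)⌉₊ : ℝ) - t * m) • q) ?_ ?_
    · exact add_mem (smul_mem_realCone hm0.le hs)
        (smul_mem_realCone (sub_nonneg.2 (Nat.le_ceil _)) hqcone)
    · rw [map_add, map_nsmul, ← hqu, ← Nat.cast_smul_eq_nsmul ℝ]
      beta_reduce at hps ⊢
      rw [← add_assoc, ← smul_add, hps]
      module
  · rw [mul_add]
    exact add_mem hy hz
  · rw [smul_eq_mul, mul_left_comm]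
    exact Ideal.mul_mem_left _ _ hy

theorem semigroup_ring_HY_integral_closure {d n : ℕ} (k : Type*) [Field k]
    (c : Fin n → Fin d → ℤ)
    (hgen : AddSubgroup.closure ((latticePoints c : Set (Fin d → ℤ))) = ⊤)
    (𝒜 ℬ : Finset ↥(latticePoints c)) (t : ℝ) (ht : 0 < t)
    (v : ↥(latticePoints c)) :
    ∀ a I : Ideal (AddMonoidAlgebra k ↥(latticePoints c)),
      a = Ideal.span ((fun u : ↥(latticePoints c) =>
            AddMonoidAlgebra.of' k ↥(latticePoints c) u) '' (𝒜 : Set ↥(latticePoints c))) →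
      I = Ideal.span ((fun u : ↥(latticePoints c) =>
            AddMonoidAlgebra.of' k ↥(latticePoints c) u) '' (ℬ : Set ↥(latticePoints c))) →
    ∀ H ExpHull : Set (Fin d → ℝ),
      H = convexHull ℝ ((fun u : ↥(latticePoints c) => castR (u : Fin d → ℤ)) ''
            (𝒜 : Set ↥(latticePoints c))) →
      ExpHull = convexHull ℝ ((fun u : ↥(latticePoints c) => castR (u : Fin d → ℤ)) ''
            {u : ↥(latticePoints c) | AddMonoidAlgebra.of' k ↥(latticePoints c) u ∈ I}) →
    (AddMonoidAlgebra.of' k ↥(latticePoints c) v ∈ HYIntCl I a t ↔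
      castR (v : Fin d → ℤ) +ᵥ t • H ⊆ ExpHull) := by
  rintro a I rfl rfl H E rfl rfl
  change _ ∈ HYIntCl (Ideal.span (AddMonoidAlgebra.of' k ↥(latticePoints c) '' _))
    (Ideal.span (AddMonoidAlgebra.of' k ↥(latticePoints c) '' _)) t ↔
    latticeEmb c v +ᵥ t • convexHull ℝ (latticeEmb c '' _) ⊆
      convexHull ℝ (latticeEmb c '' {u | AddMonoidAlgebra.of' k ↥(latticePoints c) u ∈
        Ideal.span (AddMonoidAlgebra.of' k ↥(latticePoints c) '' _)})
  rw [convexHull_exponents_eq]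
  constructor
  · intro hv
    rw [← convexHull_smul, ← convexHull_vadd]
    refine convexHull_min ?_ ((convex_convexHull ℝ _).add (convex_realCone c))
    rintro _ ⟨_, ⟨_, ⟨u, hu, rfl⟩, rfl⟩, rfl⟩
    exact add_smul_mem_of_mem_HYIntCl ℬ.finite_toSet ht hv hu
  · intro h
    exact of'_mem_HYIntCl ht fun p hp =>
      h (Set.vadd_mem_vadd_set (Set.smul_mem_smul_set hp))
end
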